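/- Let α < 1 and β < 1 satisfy |αβ| < (1−α)(1−β), let y¹, y² : [0,∞) → ℝ be continuous, and for i = 1,2 let xⁱ be a continuous function satisfying xⁱ_t = yⁱ_t + α·M^{xⁱ}_t + β·I^{xⁱ}_t for all t ≥ 0. Set D = (1−α)(1−β) − |αβ| and C = (1 + |β|/(1−β)) · ( 1 + |α|(1−β)/D + |αβ|/D ). Then for every t ≥ 0, sup_{0≤s≤t} |x¹_s − x²_s| ≤ C · sup_{0≤s≤t} |y¹_s − y²_s|. -/

import Mathlib

open Set

/-- One-sided comparison of running maxima for singly perturbed equations. -/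
lemma runningMax_sub_le {α c t : ℝ} {x₁ x₂ z₁ z₂ : ℝ → ℝ} (hα : α < 1) (ht : 0 ≤ t)
    (hc₁ : ContinuousOn x₁ (Icc 0 t)) (hc₂ : ContinuousOn x₂ (Icc 0 t))
    (h₁ : ∀ s ∈ Icc 0 t, x₁ s = z₁ s + α * sSup (x₁ '' Icc 0 s))
    (h₂ : ∀ s ∈ Icc 0 t, x₂ s = z₂ s + α * sSup (x₂ '' Icc 0 s))
    (hz : ∀ s ∈ Icc 0 t, z₁ s - z₂ s ≤ c) :
    (1 - α) * (sSup (x₁ '' Icc 0 t) - sSup (x₂ '' Icc 0 t)) ≤ c := by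
  obtain ⟨s, hs, hmax, hle⟩ :=
    isCompact_Icc.exists_sSup_image_eq_and_ge (nonempty_Icc.2 ht) hc₁
  have hst : Icc 0 s ⊆ Icc 0 t := Icc_subset_Icc_right hs.2
  have hs' : s ∈ Icc 0 s := ⟨hs.1, le_rfl⟩
  have hmax_s : sSup (x₁ '' Icc 0 s) = x₁ s :=
    IsGreatest.csSup_eq ⟨mem_image_of_mem x₁ hs', forall_mem_image.2 fun r hr => hle r (hst hr)⟩
  have hbdd : BddAbove (x₂ '' Icc 0 t) := isCompact_Icc.bddAbove_image hc₂
  have hx₂s : x₂ s ≤ sSup (x₂ '' Icc 0 s) :=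
    le_csSup (hbdd.mono (image_mono hst)) (mem_image_of_mem x₂ hs')
  have hmono : sSup (x₂ '' Icc 0 s) ≤ sSup (x₂ '' Icc 0 t) :=
    csSup_le_csSup hbdd ⟨_, mem_image_of_mem x₂ hs'⟩ (image_mono hst)
  have e₁ := h₁ s hs
  have e₂ := h₂ s hs
  have hzs := hz s hs
  have hscaled := mul_le_mul_of_nonneg_left hmono (sub_nonneg.2 hα.le)
  rw [hmax_s] at e₁
  rw [hmax]
  linarith

/-- Stability of the running maximum for singly perturbed equations. -/
lemma abs_runningMax_sub_le {α c t : ℝ} {x₁ x₂ z₁ z₂ : ℝ → ℝ} (hα : α < 1) (ht : 0 ≤ t)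
    (hc₁ : ContinuousOn x₁ (Icc 0 t)) (hc₂ : ContinuousOn x₂ (Icc 0 t))
    (h₁ : ∀ s ∈ Icc 0 t, x₁ s = z₁ s + α * sSup (x₁ '' Icc 0 s))
    (h₂ : ∀ s ∈ Icc 0 t, x₂ s = z₂ s + α * sSup (x₂ '' Icc 0 s))
    (hz : ∀ s ∈ Icc 0 t, |z₁ s - z₂ s| ≤ c) :
    (1 - α) * |sSup (x₁ '' Icc 0 t) - sSup (x₂ '' Icc 0 t)| ≤ c := by
  rcases abs_choice (sSup (x₁ '' Icc 0 t) - sSup (x₂ '' Icc 0 t)) with h | h <;> rw [h]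
  · exact runningMax_sub_le hα ht hc₁ hc₂ h₁ h₂ fun s hs => (abs_le.1 (hz s hs)).2
  · rw [neg_sub]
    exact runningMax_sub_le hα ht hc₂ hc₁ h₂ h₁ fun s hs => by
      linarith [(abs_le.1 (hz s hs)).1]

lemma sSup_image_neg_eq_neg_sInf (x : ℝ → ℝ) (s : Set ℝ) :
    sSup ((-x) '' s) = -sInf (x '' s) := by
  rw [Real.sInf_def, neg_neg, ← image_neg_eq_neg, image_image, Pi.neg_def]

/-- Stability of the running minimum for singly perturbed equations. -/
lemma abs_runningMin_sub_le {β c t : ℝ} {x₁ x₂ z₁ z₂ : ℝ → ℝ} (hβ : β < 1) (ht : 0 ≤ t)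
    (hc₁ : ContinuousOn x₁ (Icc 0 t)) (hc₂ : ContinuousOn x₂ (Icc 0 t))
    (h₁ : ∀ s ∈ Icc 0 t, x₁ s = z₁ s + β * sInf (x₁ '' Icc 0 s))
    (h₂ : ∀ s ∈ Icc 0 t, x₂ s = z₂ s + β * sInf (x₂ '' Icc 0 s))
    (hz : ∀ s ∈ Icc 0 t, |z₁ s - z₂ s| ≤ c) :
    (1 - β) * |sInf (x₁ '' Icc 0 t) - sInf (x₂ '' Icc 0 t)| ≤ c := by
  have h := abs_runningMax_sub_le (z₁ := fun s => -z₁ s) (z₂ := fun s => -z₂ s) (c := c)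
    hβ ht hc₁.neg hc₂.neg
    (fun s hs => by rw [sSup_image_neg_eq_neg_sInf, Pi.neg_apply]; linarith [h₁ s hs])
    (fun s hs => by rw [sSup_image_neg_eq_neg_sInf, Pi.neg_apply]; linarith [h₂ s hs])
    (fun s hs => by rw [neg_sub_neg, abs_sub_comm]; exact hz s hs)
  rwa [sSup_image_neg_eq_neg_sInf, sSup_image_neg_eq_neg_sInf, neg_sub_neg, abs_sub_comm] at h

/-- Running maxima of functions continuous on a compact interval stay at bounded distance. -/
lemma bddAbove_abs_runningMax_sub {t : ℝ} {x₁ x₂ : ℝ → ℝ}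
    (hc₁ : ContinuousOn x₁ (Icc 0 t)) (hc₂ : ContinuousOn x₂ (Icc 0 t)) :
    BddAbove ((fun s => |sSup (x₁ '' Icc 0 s) - sSup (x₂ '' Icc 0 s)|) '' Icc 0 t) := by
  obtain ⟨K₁, hK₁⟩ := isCompact_Icc.exists_bound_of_continuousOn hc₁
  obtain ⟨K₂, hK₂⟩ := isCompact_Icc.exists_bound_of_continuousOn hc₂
  have bound : ∀ {x : ℝ → ℝ} {K s : ℝ}, (∀ r ∈ Icc 0 t, ‖x r‖ ≤ K) → s ∈ Icc 0 t →
      |sSup (x '' Icc 0 s)| ≤ K := by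
    intro x K s hK hs
    have hst : Icc 0 s ⊆ Icc 0 t := Icc_subset_Icc_right hs.2
    have hs' : s ∈ Icc 0 s := ⟨hs.1, le_rfl⟩
    have hub : ∀ a ∈ x '' Icc 0 s, a ≤ K :=
      forall_mem_image.2 fun r hr => (abs_le.1 (hK r (hst hr))).2
    exact abs_le.2 ⟨(abs_le.1 (hK s hs)).1.trans (le_csSup ⟨K, hub⟩ (mem_image_of_mem x hs')),
      csSup_le ⟨_, mem_image_of_mem x hs'⟩ hub⟩
  exact ⟨K₁ + K₂, forall_mem_image.2 fun s hs =>
    (abs_sub _ _).trans (add_le_add (bound hK₁ hs) (bound hK₂ hs))⟩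

/-- Under `α < 1`, `β < 1` and `|αβ| < (1−α)(1−β)`, two continuous
solutions of the doubly perturbed path equation with drivers `y¹, y²` satisfy, with
`D = (1−α)(1−β) − |αβ|` and `C = (1 + |β|/(1−β))·(1 + |α|(1−β)/D + |αβ|/D)`,
`sup_{0≤s≤t} |x¹_s − x²_s| ≤ C · sup_{0≤s≤t} |y¹_s − y²_s|` for every `t ≥ 0`. -/
theorem doubly_perturbed_solution_stability
    (α β : ℝ) (hα : α < 1) (hβ : β < 1)
    (hαβ : |α * β| < (1 - α) * (1 - β))
    (y₁ y₂ : ℝ → ℝ)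
    (hy₁ : ContinuousOn y₁ (Set.Ici 0)) (hy₂ : ContinuousOn y₂ (Set.Ici 0))
    (x₁ x₂ : ℝ → ℝ)
    (hx₁_cont : ContinuousOn x₁ (Set.Ici 0)) (hx₂_cont : ContinuousOn x₂ (Set.Ici 0))
    (hx₁ : ∀ t : ℝ, 0 ≤ t →
      x₁ t = y₁ t + α * sSup (x₁ '' Set.Icc 0 t) + β * sInf (x₁ '' Set.Icc 0 t))
    (hx₂ : ∀ t : ℝ, 0 ≤ t →
      x₂ t = y₂ t + α * sSup (x₂ '' Set.Icc 0 t) + β * sInf (x₂ '' Set.Icc 0 t)) :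
    ∀ t : ℝ, 0 ≤ t →
      sSup ((fun s => |x₁ s - x₂ s|) '' Set.Icc 0 t) ≤
        ((1 + |β| / (1 - β)) *
            (1 + |α| * (1 - β) / ((1 - α) * (1 - β) - |α * β|) +
              |α * β| / ((1 - α) * (1 - β) - |α * β|))) *
          sSup ((fun s => |y₁ s - y₂ s|) '' Set.Icc 0 t) := by
  intro t ht
  have hsub : Icc 0 t ⊆ Ici (0 : ℝ) := Icc_subset_Ici_self
  have hxc₁ := hx₁_cont.mono hsub
  have hxc₂ := hx₂_cont.mono hsub
  have hne : (Icc 0 t).Nonempty := nonempty_Icc.2 ht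
  set d := sSup ((fun s => |y₁ s - y₂ s|) '' Icc 0 t)
  set m := sSup ((fun s => |sSup (x₁ '' Icc 0 s) - sSup (x₂ '' Icc 0 s)|) '' Icc 0 t)
  have hd : ∀ s ∈ Icc 0 t, |y₁ s - y₂ s| ≤ d := fun s hs =>
    le_csSup (isCompact_Icc.bddAbove_image ((hy₁.mono hsub).sub (hy₂.mono hsub)).abs)
      (mem_image_of_mem (fun s => |y₁ s - y₂ s|) hs)
  have hm : ∀ s ∈ Icc 0 t, |sSup (x₁ '' Icc 0 s) - sSup (x₂ '' Icc 0 s)| ≤ m := fun s hs =>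
    le_csSup (bddAbove_abs_runningMax_sub hxc₁ hxc₂)
      (mem_image_of_mem (fun s => |sSup (x₁ '' Icc 0 s) - sSup (x₂ '' Icc 0 s)|) hs)
  have hα' : 0 < 1 - α := sub_pos.2 hα
  have hβ' : 0 < 1 - β := sub_pos.2 hβ
  have abs_add_mul_sub_le : ∀ {γ a b p q u v : ℝ}, |a - b| ≤ u → |p - q| ≤ v →
      |(a + γ * p) - (b + γ * q)| ≤ u + |γ| * v := by
    intro γ a b p q u v hu hv
    calc |(a + γ * p) - (b + γ * q)| = |(a - b) + γ * (p - q)| := by ring_nf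
      _ ≤ |a - b| + |γ| * |p - q| := by rw [← abs_mul]; exact abs_add_le _ _
      _ ≤ u + |γ| * v := by gcongr
  have hi : ∀ s ∈ Icc 0 t, |sInf (x₁ '' Icc 0 s) - sInf (x₂ '' Icc 0 s)| ≤
      (d + |α| * m) / (1 - β) := by
    intro s hs
    have hst : Icc 0 s ⊆ Icc 0 t := Icc_subset_Icc_right hs.2
    rw [le_div_iff₀' hβ']
    exact abs_runningMin_sub_le hβ hs.1 (hxc₁.mono hst) (hxc₂.mono hst)
      (fun r hr => hx₁ r hr.1) (fun r hr => hx₂ r hr.1)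
      fun r hr => abs_add_mul_sub_le (hd r (hst hr)) (hm r (hst hr))
  have hm_le : m ≤ (d + |β| * ((d + |α| * m) / (1 - β))) / (1 - α) := by
    refine csSup_le (hne.image _) (forall_mem_image.2 fun s hs => ?_)
    have hst : Icc 0 s ⊆ Icc 0 t := Icc_subset_Icc_right hs.2
    rw [le_div_iff₀' hα']
    exact abs_runningMax_sub_le (z₁ := fun r => y₁ r + β * sInf (x₁ '' Icc 0 r))
      (z₂ := fun r => y₂ r + β * sInf (x₂ '' Icc 0 r)) hα hs.1 (hxc₁.mono hst) (hxc₂.mono hst)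
      (fun r hr => by rw [hx₁ r hr.1]; ring) (fun r hr => by rw [hx₂ r hr.1]; ring)
      fun r hr => abs_add_mul_sub_le (hd r (hst hr)) (hi r (hst hr))
  have hD : 0 < (1 - α) * (1 - β) - |α * β| := sub_pos.2 hαβ
  have hmD : m ≤ (1 - β + |β|) * d / ((1 - α) * (1 - β) - |α * β|) := by
    rw [le_div_iff₀ hD, abs_mul]
    rw [le_div_iff₀ hα', ← sub_le_iff_le_add', mul_div_assoc', le_div_iff₀ hβ'] at hm_le
    linarith
  refine csSup_le (hne.image _) (forall_mem_image.2 fun s hs => ?_)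
  calc |x₁ s - x₂ s|
      ≤ d + |α| * m + |β| * ((d + |α| * m) / (1 - β)) := by
        rw [hx₁ s hs.1, hx₂ s hs.1]
        exact abs_add_mul_sub_le (abs_add_mul_sub_le (hd s hs) (hm s hs)) (hi s hs)
    _ = (1 + |β| / (1 - β)) * (d + |α| * m) := by ring
    _ ≤ (1 + |β| / (1 - β)) *
          (d + |α| * ((1 - β + |β|) * d / ((1 - α) * (1 - β) - |α * β|))) := by
        gcongr
    _ = _ := by rw [abs_mul]; ring
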